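/- Let H : ℝ^{2n} → ℝ be continuously differentiable, let A ∈ ℝ^{2n×2k} be symplectic (Aᵀ J₂ₙ A = J₂ₖ), and let x₀ ∈ Range(A). Suppose S is a bounded open neighborhood of x₀ in ℝ^{2n} such that H(x₀) < H(x) for all x ∈ ∂S (or H(x₀) > H(x) for all x ∈ ∂S). If z : ℝ → ℝ^{2k} is differentiable and solves the reduced Hamiltonian system ż(t) = J₂ₖ ∇(H∘A)(z(t)) with z(0) = A⁺x₀, then A z(t) ∈ S for all t ∈ ℝ; in particular the reduced solution is bounded. -/

import Mathlib

open Matrix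

/-- The Poisson matrix `J₂ₘ = [[0ₘ, Iₘ], [-Iₘ, 0ₘ]]`. -/
def PoissonJ (m : ℕ) : Matrix (Fin m ⊕ Fin m) (Fin m ⊕ Fin m) ℝ :=
  Matrix.fromBlocks 0 1 (-1) 0

/-- The symplectic inverse `B⁺ = J₂ᵦᵀ Bᵀ J₂ₐ` of a `2a × 2b` real matrix `B`. -/
def symplInv {a b : ℕ} (B : Matrix (Fin a ⊕ Fin a) (Fin b ⊕ Fin b) ℝ) :
    Matrix (Fin b ⊕ Fin b) (Fin a ⊕ Fin a) ℝ :=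
  (PoissonJ b)ᵀ * Bᵀ * PoissonJ a

/-- The Euclidean gradient of `H : ℝ^ι → ℝ`: its `i`-th component is the partial
derivative of `H` in the `i`-th coordinate direction. -/
noncomputable def egrad {ι : Type*} [Fintype ι] [DecidableEq ι]
    (H : (ι → ℝ) → ℝ) (x : ι → ℝ) : ι → ℝ :=
  fun i => fderiv ℝ H x (Pi.single i 1)

theorem PoissonJ_transpose (m : ℕ) : (PoissonJ m)ᵀ = -PoissonJ m := by
  simp [PoissonJ, Matrix.fromBlocks_transpose, Matrix.fromBlocks_neg]

theorem PoissonJ_transpose_mul_self (m : ℕ) : (PoissonJ m)ᵀ * PoissonJ m = 1 := by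
  simp [PoissonJ, Matrix.fromBlocks_transpose, Matrix.fromBlocks_multiply]

theorem symplInv_mul_self {a b : ℕ} {B : Matrix (Fin a ⊕ Fin a) (Fin b ⊕ Fin b) ℝ}
    (hB : Bᵀ * PoissonJ a * B = PoissonJ b) : symplInv B * B = 1 := by
  rw [symplInv, Matrix.mul_assoc, Matrix.mul_assoc, ← Matrix.mul_assoc Bᵀ, hB,
    PoissonJ_transpose_mul_self]

theorem dotProduct_mulVec_self_of_transpose_eq_neg {ι : Type*} [Fintype ι]
    {M : Matrix ι ι ℝ} (hM : Mᵀ = -M) (v : ι → ℝ) : v ⬝ᵥ M *ᵥ v = 0 := by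
  have h : v ⬝ᵥ M *ᵥ v = -(v ⬝ᵥ M *ᵥ v) := by
    conv_lhs => rw [Matrix.dotProduct_mulVec, ← Matrix.mulVec_transpose, hM, Matrix.neg_mulVec,
      neg_dotProduct, dotProduct_comm]
  linarith

theorem fderiv_apply_eq_egrad_dotProduct {ι : Type*} [Fintype ι] [DecidableEq ι]
    (G : (ι → ℝ) → ℝ) (x v : ι → ℝ) : fderiv ℝ G x v = egrad G x ⬝ᵥ v := by
  have h := LinearMap.pi_apply_eq_sum_univ (fderiv ℝ G x).toLinearMap v
  simp only [ContinuousLinearMap.coe_coe, smul_eq_mul] at h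
  rw [h, dotProduct]
  refine Finset.sum_congr rfl fun i _ => ?_
  rw [egrad, mul_comm]
  congr 2
  ext j
  simp [Pi.single_apply, eq_comm]

/-- A differentiable Hamiltonian is constant along the solutions of its Hamiltonian system. -/
theorem hamiltonian_eq_of_hasDerivAt {m : ℕ} {G : (Fin m ⊕ Fin m → ℝ) → ℝ}
    (hG : Differentiable ℝ G) {z : ℝ → Fin m ⊕ Fin m → ℝ}
    (hz : ∀ t, HasDerivAt z ((PoissonJ m).mulVec (egrad G (z t))) t) (s t : ℝ) :
    G (z s) = G (z t) := by
  have hd : ∀ t, HasDerivAt (G ∘ z) 0 t := fun t => by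
    have h := (hG (z t)).hasFDerivAt.comp_hasDerivAt t (hz t)
    rwa [fderiv_apply_eq_egrad_dotProduct,
      dotProduct_mulVec_self_of_transpose_eq_neg (PoissonJ_transpose m)] at h
  exact is_const_of_deriv_eq_zero (fun t => (hd t).differentiableAt) (fun t => (hd t).deriv) s t

/-- Theorem 3.9 (boundedness of the symplectic-projection reduced system): if
`H : ℝ^{2n} → ℝ` is `C¹`, `A ∈ ℝ^{2n×2k}` is symplectic, `x₀ ∈ Range(A)`, and `S`
is a bounded open neighborhood of `x₀` with `H(x₀) < H(x)` for all `x ∈ ∂S` (or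
`H(x₀) > H(x)` for all `x ∈ ∂S`), then any solution `z` of the reduced Hamiltonian
system `ż = J₂ₖ ∇(H∘A)(z)` with `z(0) = A⁺x₀` satisfies `Az(t) ∈ S` for all
`t ∈ ℝ`; in particular the reduced solution is bounded. -/
theorem reduced_solution_stays_in_S {n k : ℕ}
    (H : ((Fin n ⊕ Fin n) → ℝ) → ℝ) (hH : ContDiff ℝ 1 H)
    (A : Matrix (Fin n ⊕ Fin n) (Fin k ⊕ Fin k) ℝ)
    (hA : Aᵀ * PoissonJ n * A = PoissonJ k)
    (x₀ : (Fin n ⊕ Fin n) → ℝ) (hx₀ : x₀ ∈ Set.range A.mulVec)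
    (S : Set ((Fin n ⊕ Fin n) → ℝ)) (hSopen : IsOpen S)
    (hSbdd : Bornology.IsBounded S) (hx₀S : x₀ ∈ S)
    (hbd : (∀ x ∈ frontier S, H x₀ < H x) ∨ (∀ x ∈ frontier S, H x < H x₀))
    (z : ℝ → (Fin k ⊕ Fin k) → ℝ)
    (hz : ∀ t, HasDerivAt z
      ((PoissonJ k).mulVec (egrad (fun w => H (A.mulVec w)) (z t))) t)
    (hz0 : z 0 = (symplInv A).mulVec x₀) :
    ∀ t : ℝ, A.mulVec (z t) ∈ S := by
  have hAlin : Differentiable ℝ (A.mulVec) :=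
    (Matrix.mulVecLin A).toContinuousLinearMap.differentiable
  have hAz0 : A.mulVec (z 0) = x₀ := by
    obtain ⟨w, rfl⟩ := hx₀
    rw [hz0, Matrix.mulVec_mulVec w, symplInv_mul_self hA, Matrix.one_mulVec]
  have henergy : ∀ t, H (A.mulVec (z t)) = H x₀ := fun t => by
    rw [← hAz0]
    exact hamiltonian_eq_of_hasDerivAt (G := fun w => H (A.mulVec w))
      ((hH.differentiable one_ne_zero).comp hAlin) hz t 0
  have hcont : Continuous fun t => A.mulVec (z t) :=
    hAlin.continuous.comp (continuous_iff_continuousAt.2 fun t => (hz t).continuousAt)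
  have hfr : ∀ t, A.mulVec (z t) ∉ frontier S := fun t ht => by
    rcases hbd with h | h
    · exact (h _ ht).ne' (henergy t)
    · exact (h _ ht).ne (henergy t)
  have hclopen : IsClopen ((fun t => A.mulVec (z t)) ⁻¹' S) := by
    refine ⟨?_, hSopen.preimage hcont⟩
    have heq : (fun t => A.mulVec (z t)) ⁻¹' S = (fun t => A.mulVec (z t)) ⁻¹' closure S := by
      refine Set.Subset.antisymm (Set.preimage_mono subset_closure) fun t ht => ?_
      by_contra hn
      exact hfr t ⟨ht, fun hi => hn (interior_subset (s := S) hi)⟩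
    rw [heq]
    exact isClosed_closure.preimage hcont
  have huniv := hclopen.eq_univ ⟨0, by simpa [hAz0] using hx₀S⟩
  exact fun t => Set.eq_univ_iff_forall.1 huniv t
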